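/- Let a > −1. For n ≥ 1 set h = 1/(2n+a+1) and x_i = h(a+i) for i=1,…,2n. Let L be the n×n upper bidiagonal matrix with L_{ii} = √(a+n+1−i) and L_{i,i+1} = √(n−i), and define the n×n matrix L_hard = √(2/h) · F_n Ω_n Lᵀ Ω_n F_n. Define E = L_hard − [ −2·diag(√x_2, √x_4, …, √x_{2n})·(1/(2h))∇_n + a·diag(1/√x_2, 1/√x_4, …, 1/√x_{2n})·S_n ]. Then E is upper bidiagonal with entries E_{ii} = (1/h)(√(x_{2i}+ha) − √(x_{2i})) − a/(2√(x_{2i})) for i=1,…,n and E_{i,i+1} = −(1/h)(√(x_{2i}−ha) − √(x_{2i})) − a/(2√(x_{2i})) for i=1,…,n−1; moreover, for every ε > 0 there exist C > 0 and n₀ such that for all n ≥ n₀, every entry of E in a row i with i ≥ ε/h has absolute value at most C·h. -/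

import Mathlib

open Matrix Real

noncomputable section

/-- Mesh size `h = 1/(2n+a+1)` for the hard edge of the Laguerre model. -/
def besselH (a : ℝ) (n : ℕ) : ℝ := 1 / (2 * n + a + 1)

/-- Grid points `x_i = h(a+i)`. -/
def besselX (a : ℝ) (n : ℕ) (i : ℕ) : ℝ := besselH a n * (a + i)

/-- The `n×n` ∞-Laguerre matrix model: upper bidiagonal with
`L_{ii} = √(a+n+1−i)` and `L_{i,i+1} = √(n−i)` (1-based indexing). -/
def laguerreLinf (a : ℝ) (n : ℕ) : Matrix (Fin n) (Fin n) ℝ :=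
  Matrix.of fun i j =>
    if (j : ℕ) = (i : ℕ) then Real.sqrt (a + n - (i : ℕ))
    else if (j : ℕ) = (i : ℕ) + 1 then Real.sqrt ((n : ℝ) - 1 - (i : ℕ))
    else 0

/-- The `n×n` flip permutation matrix `F`. -/
def flipMat (n : ℕ) : Matrix (Fin n) (Fin n) ℝ :=
  Matrix.of fun i j => if (i : ℕ) + (j : ℕ) = n - 1 then 1 else 0

/-- `Ω_n`, diagonal with `(i,i)` entry `(−1)^i` (1-based indexing). -/
def omegaMat (n : ℕ) : Matrix (Fin n) (Fin n) ℝ :=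
  Matrix.diagonal fun i => (-1 : ℝ) ^ ((i : ℕ) + 1)

/-- `∇_n`, upper bidiagonal with `−1` on the diagonal and `1` on the superdiagonal. -/
def gradMat (n : ℕ) : Matrix (Fin n) (Fin n) ℝ :=
  Matrix.of fun i j =>
    if (j : ℕ) = (i : ℕ) then -1 else if (j : ℕ) = (i : ℕ) + 1 then 1 else 0

/-- `S_n`, upper bidiagonal with `1/2` on the diagonal and superdiagonal. -/
def sMat (n : ℕ) : Matrix (Fin n) (Fin n) ℝ :=
  Matrix.of fun i j =>
    if (j : ℕ) = (i : ℕ) ∨ (j : ℕ) = (i : ℕ) + 1 then (1 : ℝ) / 2 else 0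

/-- The ∞-Laguerre matrix model scaled at the hard edge,
`L_hard = √(2/h)·FΩLᵀΩF`. -/
def laguerreLhard (a : ℝ) (n : ℕ) : Matrix (Fin n) (Fin n) ℝ :=
  Real.sqrt (2 / besselH a n) •
    (flipMat n * omegaMat n * (laguerreLinf a n)ᵀ * omegaMat n * flipMat n)

/-- The error term `E` in the finite difference interpretation of the
hard-edge–scaled square Laguerre model. -/
def laguerreLhardErr (a : ℝ) (n : ℕ) : Matrix (Fin n) (Fin n) ℝ :=
  laguerreLhard a n -
    ((-2 : ℝ) • (Matrix.diagonal (fun i : Fin n =>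
        Real.sqrt (besselX a n (2 * (i : ℕ) + 2))) *
      ((1 / (2 * besselH a n)) • gradMat n)) +
     a • (Matrix.diagonal (fun i : Fin n =>
        1 / Real.sqrt (besselX a n (2 * (i : ℕ) + 2))) * sMat n))

/-- First-order Taylor remainder bound for the square root. -/
lemma abs_sqrt_add_sub_le {x d : ℝ} (hx : 0 < x) (hd : 0 ≤ x + d) :
    |√(x + d) - √x - d / (2 * √x)| ≤ d ^ 2 / (2 * √x ^ 3) := by
  have hr : 0 < √x := Real.sqrt_pos.mpr hx
  have hs : 0 ≤ √(x + d) := Real.sqrt_nonneg _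
  have hr2 : √x ^ 2 = x := Real.sq_sqrt hx.le
  have hs2 : √(x + d) ^ 2 = x + d := Real.sq_sqrt hd
  generalize √x = r at *
  generalize √(x + d) = s at *
  obtain rfl : d = (s - r) * (s + r) := by linear_combination hr2 - hs2
  have h_eq : s - r - (s - r) * (s + r) / (2 * r) = -((s - r) ^ 2 / (2 * r)) := by
    field_simp
    ring
  rw [h_eq, abs_neg, abs_of_nonneg (by positivity), div_le_div_iff₀ (by positivity) (by positivity)]
  have h_sq : r ^ 2 ≤ (s + r) ^ 2 := by nlinarith
  nlinarith [mul_le_mul_of_nonneg_left h_sq (show 0 ≤ 2 * r * (s - r) ^ 2 by positivity)]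

lemma besselH_pos {a : ℝ} (ha : -1 < a) {n : ℕ} (hn : 1 ≤ n) : 0 < besselH a n := by
  have : (1 : ℝ) ≤ n := by exact_mod_cast hn
  unfold besselH
  exact one_div_pos.mpr (by linarith)

lemma sqrt_two_div_mul_sqrt {h : ℝ} (hh : 0 < h) (y : ℝ) :
    √(2 / h) * √y = 1 / h * √(h * (2 * y)) := by
  rw [← Real.sqrt_mul (by positivity),
    show 2 / h * y = (1 / h) ^ 2 * (h * (2 * y)) by field_simp,
    Real.sqrt_mul (by positivity), Real.sqrt_sq (by positivity)]

lemma flipMat_eq_submatrix_one (n : ℕ) :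
    flipMat n = (1 : Matrix (Fin n) (Fin n) ℝ).submatrix Fin.rev id := by
  ext i j
  simp only [flipMat, of_apply, submatrix_apply, id, one_apply, Fin.ext_iff, Fin.val_rev]
  congr 1
  simp only [eq_iff_iff]
  omega

lemma flipMat_mul_apply (n : ℕ) (A : Matrix (Fin n) (Fin n) ℝ) (i j : Fin n) :
    (flipMat n * A) i j = A i.rev j := by
  rw [flipMat_eq_submatrix_one, mul_apply]
  simp [one_apply]

lemma mul_flipMat_apply (n : ℕ) (A : Matrix (Fin n) (Fin n) ℝ) (i j : Fin n) :
    (A * flipMat n) i j = A i j.rev := by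
  rw [flipMat_eq_submatrix_one, mul_apply]
  simp [one_apply, Fin.rev_eq_iff]

lemma laguerreLhard_apply (a : ℝ) (n : ℕ) (i j : Fin n) :
    laguerreLhard a n i j = √(2 / besselH a n) *
      ((-1) ^ ((i.rev : ℕ) + 1) * laguerreLinf a n j.rev i.rev * (-1) ^ ((j.rev : ℕ) + 1)) := by
  simp only [laguerreLhard, Matrix.mul_assoc, Matrix.smul_apply, smul_eq_mul, flipMat_mul_apply]
  simp only [← Matrix.mul_assoc, mul_flipMat_apply]
  simp only [omegaMat, mul_diagonal, diagonal_mul, transpose_apply]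

lemma laguerreLhard_apply_of_ne (a : ℝ) (n : ℕ) (i j : Fin n) (h₀ : (j : ℕ) ≠ i)
    (h₁ : (j : ℕ) ≠ i + 1) : laguerreLhard a n i j = 0 := by
  rw [laguerreLhard_apply, laguerreLinf, of_apply, if_neg, if_neg] <;>
    simp only [Fin.val_rev, mul_zero, zero_mul] <;> omega

lemma laguerreLhard_apply_self (a : ℝ) (n : ℕ) (i : Fin n) :
    laguerreLhard a n i i = √(2 / besselH a n) * √(a + i + 1) := by
  have h_cast : ((i.rev : ℕ) : ℝ) = n - (i + 1) := by
    rw [Fin.val_rev, Nat.cast_sub (by omega)]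
    push_cast
    ring
  rw [laguerreLhard_apply, mul_right_comm, ← pow_add, Even.neg_one_pow ⟨_, rfl⟩, one_mul,
    laguerreLinf, of_apply, if_pos rfl, h_cast]
  ring_nf

lemma laguerreLhard_apply_succ (a : ℝ) (n : ℕ) (i j : Fin n) (hij : (j : ℕ) = i + 1) :
    laguerreLhard a n i j = -(√(2 / besselH a n) * √(i + 1)) := by
  have h_rev : (i.rev : ℕ) = j.rev + 1 := by
    simp only [Fin.val_rev]
    omega
  have h_cast : ((j.rev : ℕ) : ℝ) = n - (i + 2) := by
    rw [Fin.val_rev, Nat.cast_sub (by omega), hij]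
    push_cast
    ring
  have h_odd : Odd ((j.rev : ℕ) + 1 + 1 + (j.rev + 1)) := ⟨j.rev + 1, by ring⟩
  rw [laguerreLhard_apply, mul_right_comm, h_rev, ← pow_add, h_odd.neg_one_pow,
    laguerreLinf, of_apply, if_neg (by omega), if_pos h_rev, h_cast]
  ring_nf

lemma laguerreLhardErr_apply (a : ℝ) (n : ℕ) (i j : Fin n) :
    laguerreLhardErr a n i j = laguerreLhard a n i j -
      (-2 * (√(besselX a n (2 * i + 2)) * (1 / (2 * besselH a n) * gradMat n i j)) +
        a * (1 / √(besselX a n (2 * i + 2)) * sMat n i j)) := by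
  simp only [laguerreLhardErr, Matrix.sub_apply, Matrix.add_apply, Matrix.smul_apply, smul_eq_mul,
    diagonal_mul]

lemma laguerreLhardErr_apply_of_ne (a : ℝ) (n : ℕ) (i j : Fin n) (h₀ : (j : ℕ) ≠ i)
    (h₁ : (j : ℕ) ≠ i + 1) : laguerreLhardErr a n i j = 0 := by
  rw [laguerreLhardErr_apply, laguerreLhard_apply_of_ne a n i j h₀ h₁]
  simp [gradMat, sMat, h₀, h₁]

lemma laguerreLhardErr_apply_self {a : ℝ} (ha : -1 < a) {n : ℕ} (hn : 1 ≤ n) (i : Fin n) :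
    laguerreLhardErr a n i i =
      (1 / besselH a n) * (√(besselX a n (2 * i + 2) + besselH a n * a)
          - √(besselX a n (2 * i + 2))) - a / (2 * √(besselX a n (2 * i + 2))) := by
  have h_arg : besselX a n (2 * i + 2) + besselH a n * a = besselH a n * (2 * (a + i + 1)) := by
    simp only [besselX]
    push_cast
    ring
  rw [laguerreLhardErr_apply, laguerreLhard_apply_self, sqrt_two_div_mul_sqrt (besselH_pos ha hn),
    h_arg]
  simp only [gradMat, sMat, of_apply, if_true, true_or]
  ring

lemma laguerreLhardErr_apply_succ {a : ℝ} (ha : -1 < a) {n : ℕ} (hn : 1 ≤ n) (i j : Fin n)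
    (hij : (j : ℕ) = i + 1) :
    laguerreLhardErr a n i j =
      -(1 / besselH a n) * (√(besselX a n (2 * i + 2) - besselH a n * a)
          - √(besselX a n (2 * i + 2))) - a / (2 * √(besselX a n (2 * i + 2))) := by
  have h_arg : besselX a n (2 * i + 2) - besselH a n * a = besselH a n * (2 * (i + 1)) := by
    simp only [besselX]
    push_cast
    ring
  rw [laguerreLhardErr_apply, laguerreLhard_apply_succ a n i j hij,
    sqrt_two_div_mul_sqrt (besselH_pos ha hn), h_arg]
  simp only [gradMat, sMat, of_apply, hij, if_true, or_true, Nat.succ_ne_self, if_false]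
  ring

/-- A row `i` with `i ≥ ε / h` sits over a mesh point that is at least `ε`. -/
lemma le_besselX {a : ℝ} (ha : -1 < a) {n : ℕ} (hn : 1 ≤ n) {ε : ℝ} {i : ℕ}
    (hi : ε / besselH a n ≤ (i : ℝ) + 1) : ε ≤ besselX a n (2 * i + 2) := by
  have hh := besselH_pos ha hn
  rw [div_le_iff₀' hh] at hi
  refine hi.trans (mul_le_mul_of_nonneg_left ?_ hh.le)
  push_cast
  linarith [(Nat.cast_nonneg i : (0 : ℝ) ≤ i)]

lemma abs_laguerreLhardErr_le {a : ℝ} (ha : -1 < a) {n : ℕ} (hn : 1 ≤ n) {ε : ℝ} (hε : 0 < ε)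
    (i j : Fin n) (hi : ε / besselH a n ≤ (i : ℕ) + 1) :
    |laguerreLhardErr a n i j| ≤ a ^ 2 / (2 * √ε ^ 3) * besselH a n := by
  have hh := besselH_pos ha hn
  have hεx := le_besselX ha hn hi
  have hi0 : (0 : ℝ) ≤ (i : ℕ) := Nat.cast_nonneg _
  have h_add : 0 ≤ besselX a n (2 * i + 2) + besselH a n * a := by
    rw [besselX, ← mul_add]
    refine mul_nonneg hh.le ?_
    push_cast
    linarith
  have h_sub : 0 ≤ besselX a n (2 * i + 2) + -(besselH a n * a) := by
    rw [besselX, ← mul_neg, ← mul_add]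
    refine mul_nonneg hh.le ?_
    push_cast
    linarith
  have h_coef : 1 / besselH a n * ((besselH a n * a) ^ 2 / (2 * √(besselX a n (2 * i + 2)) ^ 3)) ≤
      a ^ 2 / (2 * √ε ^ 3) * besselH a n := by
    have hε' : 0 < √ε := Real.sqrt_pos.mpr hε
    have h_sqrt := Real.sqrt_le_sqrt hεx
    calc _ = a ^ 2 / (2 * √(besselX a n (2 * i + 2)) ^ 3) * besselH a n := by
          field_simp
      _ ≤ _ := by gcongr
  by_cases h₀ : (j : ℕ) = i
  · obtain rfl := Fin.ext h₀
    refine le_trans (le_of_eq ?_) ((mul_le_mul_of_nonneg_left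
      (abs_sqrt_add_sub_le (hε.trans_le hεx) h_add) (one_div_pos.mpr hh).le).trans h_coef)
    rw [laguerreLhardErr_apply_self ha hn, ← abs_of_pos (one_div_pos.mpr hh), ← abs_mul,
      abs_of_pos (one_div_pos.mpr hh)]
    congr 1
    field_simp
  by_cases h₁ : (j : ℕ) = i + 1
  · rw [← neg_sq (besselH a n * a)] at h_coef
    refine le_trans (le_of_eq ?_) ((mul_le_mul_of_nonneg_left
      (abs_sqrt_add_sub_le (hε.trans_le hεx) h_sub) (one_div_pos.mpr hh).le).trans h_coef)
    rw [laguerreLhardErr_apply_succ ha hn i j h₁, ← abs_of_pos (one_div_pos.mpr hh), ← abs_mul,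
      abs_of_pos (one_div_pos.mpr hh), ← abs_neg, ← sub_eq_add_neg]
    congr 1
    field_simp
    ring
  · rw [laguerreLhardErr_apply_of_ne a n i j h₀ h₁, abs_zero]
    positivity

/-- the hard-edge–scaled square ∞-Laguerre matrix model is a
finite difference scheme for the Bessel operator `−2√x d/dx + a/√x`: the error
term `E` is upper bidiagonal with the stated explicit entries, and for each
`ε > 0` its entries in rows `i ≥ ε/h` are uniformly `O(h)`. -/
theorem laguerreLhard_finite_difference (a : ℝ) (ha : -1 < a) :
    (∀ n : ℕ, 1 ≤ n → ∀ i j : Fin n,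
      (j : ℕ) ≠ (i : ℕ) → (j : ℕ) ≠ (i : ℕ) + 1 → laguerreLhardErr a n i j = 0) ∧
    (∀ n : ℕ, 1 ≤ n → ∀ i : Fin n,
      laguerreLhardErr a n i i =
        (1 / besselH a n) * (Real.sqrt (besselX a n (2 * (i : ℕ) + 2) + besselH a n * a)
            - Real.sqrt (besselX a n (2 * (i : ℕ) + 2)))
          - a / (2 * Real.sqrt (besselX a n (2 * (i : ℕ) + 2)))) ∧
    (∀ n : ℕ, 1 ≤ n → ∀ i j : Fin n, (j : ℕ) = (i : ℕ) + 1 →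
      laguerreLhardErr a n i j =
        -(1 / besselH a n) * (Real.sqrt (besselX a n (2 * (i : ℕ) + 2) - besselH a n * a)
            - Real.sqrt (besselX a n (2 * (i : ℕ) + 2)))
          - a / (2 * Real.sqrt (besselX a n (2 * (i : ℕ) + 2)))) ∧
    (∀ ε : ℝ, 0 < ε → ∃ C > (0 : ℝ), ∃ n₀ : ℕ, ∀ n : ℕ, n₀ ≤ n → ∀ i j : Fin n,
      ε / besselH a n ≤ ((i : ℕ) + 1 : ℝ) →
        |laguerreLhardErr a n i j| ≤ C * besselH a n) := by
  refine ⟨fun n _ i j => laguerreLhardErr_apply_of_ne a n i j,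
    fun n hn i => laguerreLhardErr_apply_self ha hn i,
    fun n hn i j => laguerreLhardErr_apply_succ ha hn i j, fun ε hε => ?_⟩
  refine ⟨a ^ 2 / (2 * √ε ^ 3) + 1, by positivity, 1, fun n hn i j hi => ?_⟩
  refine (abs_laguerreLhardErr_le ha hn hε i j hi).trans ?_
  have := besselH_pos ha hn
  gcongr
  linarith

end
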